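/- The map Φ = (R_1∘R_2∘⋯∘R_{n−1})∘⋯∘(R_1∘R_2∘R_3)∘(R_1∘R_2)∘(R_1) is a well-defined weight-preserving bijection from O_n (oriented complete monotone triangles of order n) to T_n (tournaments on {1,...,n}), with inverse Ψ = (L_1)∘(L_2∘L_1)∘⋯∘(L_{n−1}∘⋯∘L_2∘L_1). -/

import Mathlib

open Finset
open scoped Classical

/-- Symbols occurring in a triangle: `x i`, `y i` (indices `1,...,n` encoded by `Fin n`),
`a i j`, `b i j` (the edge `{i+1,j+1}` oriented from smaller to larger, resp. larger to
smaller), and the numbers `1,...,n` of the bottom row. -/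
inductive TSym (n : ℕ) where
  | x (i : Fin n)
  | y (i : Fin n)
  | a (i j : Fin n)
  | b (i j : Fin n)
  | num (i : Fin n)
deriving DecidableEq

/-- A triangle of order `n`: row `r` (0-indexed) has `r+1` entries. -/
def Tri (n : ℕ) := ∀ r : Fin n, Fin (r.val + 1) → TSym n

namespace TSym

variable {n : ℕ}

/-- The symbol lies in `𝒳`. -/
def isX : TSym n → Prop
  | .x _ => True
  | .y _ => True
  | _ => False

/-- The symbol lies in `𝒱_k`. -/
def isV (k : ℕ) : TSym n → Prop
  | .a i j => j.val = i.val + k ∧ 0 < k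
  | .b i j => j.val = i.val + k ∧ 0 < k
  | _ => False

/-- Well-formedness of a non-bottom entry: `a i j` and `b i j` require `i < j`;
numbers may not occur. -/
def wf : TSym n → Prop
  | .a i j => i < j
  | .b i j => i < j
  | .num _ => False
  | _ => True

/-- The left value of a symbol lying in a row of rank `t` (values are `1`-based). -/
def lval (t : ℕ) : TSym n → ℤ
  | .x i => (i.val : ℤ) + 1
  | .y j => (j.val : ℤ) + 1 - t
  | .a i _ => (i.val : ℤ) + 1
  | .b i _ => (i.val : ℤ) + 1
  | .num i => (i.val : ℤ) + 1

/-- The right value of a symbol lying in a row of rank `t`. -/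
def rval (t : ℕ) : TSym n → ℤ
  | .x i => (i.val : ℤ) + 1 + t
  | .y j => (j.val : ℤ) + 1
  | .a _ j => (j.val : ℤ) + 1
  | .b _ j => (j.val : ℤ) + 1
  | .num i => (i.val : ℤ) + 1

end TSym

variable {n : ℕ}

/-- Row `r` is an `𝒳`-row. -/
def IsXRow (t : Tri n) (r : Fin n) : Prop := ∀ i, (t r i).isX

/-- Row `r` has all entries in `𝒱_k`. -/
def IsVRowOf (t : Tri n) (r : Fin n) (k : ℕ) : Prop := ∀ i, (t r i).isV k

/-- Row `r` is a `𝒱`-row. -/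
def IsVRow (t : Tri n) (r : Fin n) : Prop := ∃ k, IsVRowOf t r k

/-- The bottom row is `(1,2,...,n)`. -/
def BottomOK (t : Tri n) : Prop :=
  ∀ (r : Fin n), r.val = n - 1 → ∀ i : Fin (r.val + 1),
    t r i = .num ⟨i.val, by have := i.isLt; have := r.isLt; omega⟩

/-- All non-bottom entries are well-formed. -/
def WellFormed (t : Tri n) : Prop :=
  ∀ r : Fin n, r.val < n - 1 → ∀ i, (t r i).wf

/-- `rk m` is the rank of (1-based) row `m`, for `0 ≤ m ≤ n`; Lean row index `r`
corresponds to row `r+1`.  An admissible ranking: the bottom row has rank `0`,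
row `n-1` has rank `1`, and going up, an `𝒳`-row keeps the rank while a row whose
entries lie in `𝒱_k` has rank `k` and raises the rank above it to `k+1`. -/
def IsRanking (t : Tri n) (rk : ℕ → ℕ) : Prop :=
  rk n = 0 ∧ (1 ≤ n → rk (n - 1) = 1) ∧
  ∀ r : Fin n, r.val < n - 1 →
    (IsXRow t r ∧ rk r.val = rk (r.val + 1)) ∨
    (IsVRowOf t r (rk (r.val + 1)) ∧ rk r.val = rk (r.val + 1) + 1)

/-- The monotone diagonal and monotone row properties: for every local arrangement
`v` directly above consecutive entries `u, w`, we require `l(u) ≤ l(v)` (strict when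
`u` is a `y`), `r(v) ≤ r(w)` (strict when `w` is an `x`), and `l(u) < l(w)`. -/
def MonoProps (t : Tri n) (rk : ℕ → ℕ) : Prop :=
  ∀ (r : Fin n) (hr : 1 ≤ r.val) (p : ℕ) (hp : p + 1 < r.val + 1),
    let u := t r ⟨p, by omega⟩
    let w := t r ⟨p + 1, by omega⟩
    let v := t ⟨r.val - 1, by have := r.isLt; omega⟩ ⟨p, by simp only [Fin.val_mk]; omega⟩
    (u.lval (rk (r.val + 1)) ≤ v.lval (rk r.val)) ∧
    ((∃ j, u = .y j) → u.lval (rk (r.val + 1)) < v.lval (rk r.val)) ∧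
    (v.rval (rk r.val) ≤ w.rval (rk (r.val + 1))) ∧
    ((∃ j, w = .x j) → v.rval (rk r.val) < w.rval (rk (r.val + 1))) ∧
    (u.lval (rk (r.val + 1)) < w.lval (rk (r.val + 1)))

/-- Admissibility of a triangle. -/
def IsAdmissible (t : Tri n) : Prop :=
  BottomOK t ∧ WellFormed t ∧ ∃ rk, IsRanking t rk ∧ MonoProps t rk

/-- The rank of the row with Lean index `r` (i.e. of row `r+1`), computed directly:
one more than the number of `𝒱`-rows strictly below it (above the bottom row). -/
noncomputable def rankOf (t : Tri n) (r : ℕ) : ℕ :=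
  1 + ((univ : Finset (Fin n)).filter fun s => r < s.val ∧ IsVRow t s).card

open MvPolynomial in
/-- The weight of a symbol. -/
noncomputable def TSym.weight : TSym n → MvPolynomial (Fin n ⊕ Fin n) ℤ
  | .x i => X (Sum.inl i)
  | .y j => X (Sum.inr j)
  | .a i _ => X (Sum.inl i)
  | .b _ j => X (Sum.inr j)
  | .num _ => 1

/-- The weight of a triangle: the product of the weights of its non-bottom entries. -/
noncomputable def weight (t : Tri n) : MvPolynomial (Fin n ⊕ Fin n) ℤ :=
  ∏ r : Fin n, if r.val < n - 1 then ∏ i, (t r i).weight else 1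

/-- The raising operator `R_d` (`1 ≤ d < n`), acting on (paper-indexed) rows `d-1`
and `d`, i.e. Lean rows `d-2` and `d-1`. -/
noncomputable def Raise (d : ℕ) (t : Tri n) : Tri n := fun r i =>
  if hu : 2 ≤ d ∧ r.val + 2 = d ∧ r.val + 1 < n then
    -- row d-1: swap with the entry diagonally below, else convert to an 𝒳-symbol
    match t r i with
    | .b j k =>
        if t ⟨r.val + 1, hu.2.2⟩ ⟨i.val, by have := i.isLt; simp only [Fin.val_mk]; omega⟩
            = .x j then .x j else .y k
    | .a j k =>
        if t ⟨r.val + 1, hu.2.2⟩ ⟨i.val + 1, by have := i.isLt; simp only [Fin.val_mk]; omega⟩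
            = .y k then .y k else .x j
    | s => s
  else if hl : r.val + 1 = d then
    -- row d: swap with the entry diagonally above, else convert to a 𝒱-symbol
    let tk := rankOf t r.val
    match t r i with
    | .x j =>
        if hi : i.val < r.val then
          match t ⟨r.val - 1, by have := r.isLt; omega⟩
              ⟨i.val, by simp only [Fin.val_mk]; omega⟩ with
          | .b j' k => if j' = j then .b j' k
              else if h2 : j.val + tk < n then .a j ⟨j.val + tk, h2⟩ else .x j
          | _ => if h2 : j.val + tk < n then .a j ⟨j.val + tk, h2⟩ else .x j
        else if h2 : j.val + tk < n then .a j ⟨j.val + tk, h2⟩ else .x j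
    | .y k =>
        if hi : 1 ≤ i.val then
          match t ⟨r.val - 1, by have := r.isLt; omega⟩
              ⟨i.val - 1, by have := i.isLt; simp only [Fin.val_mk]; omega⟩ with
          | .a j k' => if k' = k then .a j k'
              else if h2 : tk ≤ k.val then .b ⟨k.val - tk, by have := k.isLt; omega⟩ k
              else .y k
          | _ => if h2 : tk ≤ k.val then .b ⟨k.val - tk, by have := k.isLt; omega⟩ k
              else .y k
        else if h2 : tk ≤ k.val then .b ⟨k.val - tk, by have := k.isLt; omega⟩ k else .y k
    | s => s
  else t r i

/-- The lowering operator `L_d` (`1 ≤ d < n`), inverse to `R_d`. -/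
noncomputable def Lower (d : ℕ) (t : Tri n) : Tri n := fun r i =>
  if hu : 2 ≤ d ∧ r.val + 2 = d ∧ r.val + 1 < n then
    -- row d-1: swap with the entry diagonally below, else convert to a 𝒱-symbol
    let tk := rankOf t (r.val + 1)
    match t r i with
    | .x j =>
        (match t ⟨r.val + 1, hu.2.2⟩ ⟨i.val, by have := i.isLt; simp only [Fin.val_mk]; omega⟩ with
          | .b j' k => if j' = j then .b j' k
              else if h2 : j.val + tk < n then .a j ⟨j.val + tk, h2⟩ else .x j
          | _ => if h2 : j.val + tk < n then .a j ⟨j.val + tk, h2⟩ else .x j)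
    | .y k =>
        (match t ⟨r.val + 1, hu.2.2⟩
            ⟨i.val + 1, by have := i.isLt; simp only [Fin.val_mk]; omega⟩ with
          | .a j k' => if k' = k then .a j k'
              else if h2 : tk ≤ k.val then .b ⟨k.val - tk, by have := k.isLt; omega⟩ k
              else .y k
          | _ => if h2 : tk ≤ k.val then .b ⟨k.val - tk, by have := k.isLt; omega⟩ k
              else .y k)
    | s => s
  else if hl : r.val + 1 = d then
    -- row d: swap with the entry diagonally above, else convert to an 𝒳-symbol
    match t r i with
    | .b j k =>
        if hi : i.val < r.val then
          (if t ⟨r.val - 1, by have := r.isLt; omega⟩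
              ⟨i.val, by simp only [Fin.val_mk]; omega⟩ = .x j then .x j else .y k)
        else .y k
    | .a j k =>
        if hi : 1 ≤ i.val then
          (if t ⟨r.val - 1, by have := r.isLt; omega⟩
              ⟨i.val - 1, by have := i.isLt; simp only [Fin.val_mk]; omega⟩ = .y k
           then .y k else .x j)
        else .x j
    | s => s
  else t r i

/-- The numerical value of an `𝒳`-symbol or a bottom-row number. -/
def xyval {n : ℕ} : TSym n → ℤ
  | .x i => (i.val : ℤ) + 1
  | .y i => (i.val : ℤ) + 1
  | .a _ _ => 0
  | .b _ _ => 0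
  | .num i => (i.val : ℤ) + 1

/-- `t` is (the triangle encoding of) an oriented complete monotone triangle:
all non-bottom rows are `𝒳`-rows, the underlying numerical triangle is a complete
monotone triangle, and orientations are forced as prescribed: an entry equal to its
lower-left neighbour is an `x` (right-oriented), an entry equal to its lower-right
neighbour is a `y` (left-oriented). -/
def IsOCMTTri {n : ℕ} (t : Tri n) : Prop :=
  BottomOK t ∧
  (∀ r : Fin n, r.val < n - 1 → IsXRow t r) ∧
  (∀ (r : Fin n) (p q : Fin (r.val + 1)), p < q → xyval (t r p) < xyval (t r q)) ∧
  (∀ (r : Fin n) (h : r.val + 1 < n) (p : Fin (r.val + 1)),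
      xyval (t ⟨r.val + 1, h⟩ ⟨p.val, by have := p.isLt; simp only [Fin.val_mk]; omega⟩)
          ≤ xyval (t r p) ∧
      xyval (t r p)
          ≤ xyval (t ⟨r.val + 1, h⟩ ⟨p.val + 1, by have := p.isLt; simp only [Fin.val_mk]; omega⟩)) ∧
  (∀ (r : Fin n) (h : r.val + 1 < n) (p : Fin (r.val + 1)),
      (xyval (t ⟨r.val + 1, h⟩ ⟨p.val, by have := p.isLt; simp only [Fin.val_mk]; omega⟩)
          = xyval (t r p) → ∃ j, t r p = .x j) ∧
      (xyval (t r p)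
          = xyval (t ⟨r.val + 1, h⟩ ⟨p.val + 1, by have := p.isLt; simp only [Fin.val_mk]; omega⟩)
          → ∃ j, t r p = .y j))

/-- `t` is (the triangle encoding of) a tournament on `{1,...,n}`: all non-bottom
rows are `𝒱`-rows, and the `p`-th entry (0-indexed) of the row with Lean index `r`
carries the subscript pair `(p+1, p+1+(n-1-r))`. -/
def IsTournTri {n : ℕ} (t : Tri n) : Prop :=
  BottomOK t ∧
  ∀ (r : Fin n) (hr : r.val < n - 1) (p : Fin (r.val + 1)),
    t r p = .a ⟨p.val, by have := p.isLt; have := r.isLt; omega⟩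
              ⟨p.val + (n - 1 - r.val), by have := p.isLt; omega⟩ ∨
    t r p = .b ⟨p.val, by have := p.isLt; have := r.isLt; omega⟩
              ⟨p.val + (n - 1 - r.val), by have := p.isLt; omega⟩

variable {n : ℕ} in
/-- `raiseBlock m` applies `R_m, R_{m-1}, ..., R_1` in this order,
i.e. it is `R_1 ∘ R_2 ∘ ⋯ ∘ R_m`. -/
noncomputable def raiseBlock : ℕ → Tri n → Tri n
  | 0 => id
  | m + 1 => fun t => raiseBlock m (Raise (m + 1) t)

variable {n : ℕ} in
/-- `PhiFun m = (R_1∘⋯∘R_m) ∘ ⋯ ∘ (R_1∘R_2) ∘ (R_1)`; the map `Φ` is `PhiFun (n-1)`. -/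
noncomputable def PhiFun : ℕ → Tri n → Tri n
  | 0 => id
  | m + 1 => fun t => raiseBlock (m + 1) (PhiFun m t)

variable {n : ℕ} in
/-- `lowerBlock m` is `L_m ∘ ⋯ ∘ L_2 ∘ L_1` (applying `L_1` first). -/
noncomputable def lowerBlock : ℕ → Tri n → Tri n
  | 0 => id
  | m + 1 => fun t => Lower (m + 1) (lowerBlock m t)

variable {n : ℕ} in
/-- `PsiFun m = (L_1) ∘ (L_2∘L_1) ∘ ⋯ ∘ (L_m∘⋯∘L_1)`; the map `Ψ` is `PsiFun (n-1)`. -/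
noncomputable def PsiFun : ℕ → Tri n → Tri n
  | 0 => id
  | m + 1 => fun t => PsiFun m (lowerBlock (m + 1) t)


/-- The symbol `s` of a row of rank `k` has left value `l` (counted from `0`); it is a `𝒱`-symbol
iff `V` holds, and it is one of `y`, `b` iff `b` holds. -/
def Encodes {n : ℕ} (V : Prop) (k l : ℤ) (b : Prop) : TSym n → Prop
  | .x i => ¬V ∧ ¬b ∧ (i.val : ℤ) = l
  | .y j => ¬V ∧ b ∧ (j.val : ℤ) = l + k
  | .a i j => V ∧ ¬b ∧ (i.val : ℤ) = l ∧ (j.val : ℤ) = l + k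
  | .b i j => V ∧ b ∧ (i.val : ℤ) = l ∧ (j.val : ℤ) = l + k
  | .num _ => False

/-- The triangle `t` has left values `L` and left-orientations `B`, when the `𝒱`-rows are given
by `V` and the ranks by `k`. -/
structure Represents {n : ℕ} (t : Tri n) (V : ℕ → Prop) (k : ℕ → ℤ) (L : ℕ → ℕ → ℤ)
    (B : ℕ → ℕ → Prop) : Prop where
  bottom : BottomOK t
  entry : ∀ (r : Fin n) (p : Fin (r.val + 1)), r.val + 1 < n →
    Encodes (V r) (k r) (L r p) (B r p) (t r p)

/-- Admissibility, in terms of left values and orientations. -/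
structure AdmissibleValues (n : ℕ) (V : ℕ → Prop) (k : ℕ → ℤ) (L : ℕ → ℕ → ℤ)
    (B : ℕ → ℕ → Prop) : Prop where
  bottom : ∀ r p, r + 1 = n → p ≤ r → L r p = p
  bounds : ∀ r p, r < n → p ≤ r → 0 ≤ L r p ∧ L r p + k r < n
  row : ∀ r p, r < n → p < r → L r p < L r (p + 1)
  left : ∀ r p, r + 1 < n → p ≤ r →
    L (r + 1) p ≤ L r p ∧ (¬V (r + 1) → B (r + 1) p → L (r + 1) p < L r p)
  right : ∀ r p, r + 1 < n → p ≤ r →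
    L r p + k r ≤ L (r + 1) (p + 1) + k (r + 1) ∧
    (¬V (r + 1) → ¬B (r + 1) (p + 1) → L r p + k r < L (r + 1) (p + 1) + k (r + 1))

/-- Raising turns the `𝒳`-row `e` into a `𝒱`-row and the `𝒱`-row above it into an `𝒳`-row;
`V`, `k` describe the triangle before, and `V'`, `k'` after the move. -/
structure RaiseStep (n e : ℕ) (V V' : ℕ → Prop) (k k' : ℕ → ℤ) : Prop where
  lt : e + 1 < n
  low : ¬V e ∧ V' e ∧ k' e = k e
  upper : ∀ r, r + 1 = e → V r ∧ ¬V' r ∧ k r = k e ∧ k' r = k e + 1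
  top : ∀ r, r + 2 = e → k r = k e + 1
  other : ∀ r, r ≠ e → r + 1 ≠ e → (V' r ↔ V r) ∧ k' r = k r

/-- The orientations after raising at row `e`. -/
def raiseB (e : ℕ) (L : ℕ → ℕ → ℤ) (B : ℕ → ℕ → Prop) (r p : ℕ) : Prop :=
  if r + 1 = e then
    (B r p ∧ ¬(¬B (r + 1) p ∧ L (r + 1) p = L r p)) ∨
      (¬B r p ∧ B (r + 1) (p + 1) ∧ L (r + 1) (p + 1) = L r p)
  else if r = e then
    (B r p ∧ ¬(1 ≤ p ∧ ¬B (r - 1) (p - 1) ∧ L (r - 1) (p - 1) = L r p)) ∨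
      (¬B r p ∧ p < r ∧ B (r - 1) p ∧ L (r - 1) p = L r p)
  else B r p

/-- The left values after raising at row `e`. -/
noncomputable def raiseL (e : ℕ) (L : ℕ → ℕ → ℤ) (B : ℕ → ℕ → Prop) (r p : ℕ) : ℤ :=
  if r + 1 = e ∧ raiseB e L B r p then L r p - 1 else L r p

/-- The orientations after lowering at row `e`. -/
def lowerB (e : ℕ) (L : ℕ → ℕ → ℤ) (B : ℕ → ℕ → Prop) (r p : ℕ) : Prop :=
  if r + 1 = e then
    (B r p ∧ ¬(¬B (r + 1) (p + 1) ∧ L (r + 1) (p + 1) = L r p + 1)) ∨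
      (¬B r p ∧ B (r + 1) p ∧ L (r + 1) p = L r p)
  else if r = e then
    (B r p ∧ ¬(p < r ∧ ¬B (r - 1) p ∧ L (r - 1) p = L r p)) ∨
      (¬B r p ∧ 1 ≤ p ∧ B (r - 1) (p - 1) ∧ L (r - 1) (p - 1) + 1 = L r p)
  else B r p

/-- The left values after lowering at row `e`. -/
noncomputable def lowerL (e : ℕ) (L : ℕ → ℕ → ℤ) (B : ℕ → ℕ → Prop) (r p : ℕ) : ℤ :=
  if r + 1 = e ∧ B r p then L r p + 1 else L r p

section Values

variable {n e : ℕ} {V V' : ℕ → Prop} {k k' : ℕ → ℤ} {L : ℕ → ℕ → ℤ} {B : ℕ → ℕ → Prop}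

/-- The interlacing of the rows `e - 1` and `e` after raising. -/
lemma raiseL_interlace (hs : RaiseStep n e V V' k k') (h : AdmissibleValues n V k L B) {r p : ℕ}
    (hr : r + 1 = e) (hp : p ≤ r) :
    L (r + 1) p ≤ raiseL e L B r p ∧ raiseL e L B r p < L (r + 1) (p + 1) := by
  have h1 := h.left r p (by have := hs.lt; omega) hp
  have h2 := h.right r p (by have := hs.lt; omega) hp
  have h3 := h.row (r + 1) p (by have := hs.lt; omega) (by omega)
  have h4 := hs.upper r hr
  have h5 := hs.low
  subst hr
  simp only [raiseL, raiseB]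
  grind

lemma AdmissibleValues.raise (hs : RaiseStep n e V V' k k') (h : AdmissibleValues n V k L B) :
    AdmissibleValues n V' k' (raiseL e L B) (raiseB e L B) := by
  have hlt := hs.lt
  have hL : ∀ r p, r + 1 ≠ e → raiseL e L B r p = L r p := by
    intro r p hr; simp [raiseL, hr]
  refine ⟨fun r p hr hp => ?_, fun r p hr hp => ?_, fun r p hr hp => ?_, fun r p hr hp => ?_,
    fun r p hr hp => ?_⟩
  · rw [hL r p (by omega)]; exact h.bottom r p hr hp
  · by_cases hre : r + 1 = e
    · have h1 := raiseL_interlace hs h hre hp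
      have h2 := h.bounds (r + 1) p (by omega) (by omega)
      have h3 := h.bounds (r + 1) (p + 1) (by omega) (by omega)
      have h4 := hs.upper r hre
      rw [hre] at *
      omega
    · rw [hL r p hre]
      have h1 := h.bounds r p hr hp
      have h2 := hs.other r
      have h3 := hs.low
      grind
  · by_cases hre : r + 1 = e
    · have h1 := raiseL_interlace hs h hre (p := p) (by omega)
      have h2 := raiseL_interlace hs h hre (p := p + 1) (by omega)
      omega
    · rw [hL _ _ hre, hL _ _ hre]
      exact h.row r p hr hp
  · by_cases hre : r + 1 = e
    · have h1 := raiseL_interlace hs h hre hp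
      have h2 := hs.low
      rw [hL (r + 1) p (by omega)]
      rw [hre] at *
      exact ⟨h1.1, fun hV => absurd h2.2.1 hV⟩
    · rw [hL r p hre]
      have h1 := h.left r p hr hp
      by_cases hre2 : r + 2 = e
      · simp only [raiseL]
        grind
      · rw [hL (r + 1) p (by omega)]
        refine ⟨h1.1, fun hV => ?_⟩
        have h2 := hs.other (r + 1)
        have h3 := hs.low
        simp only [raiseB]
        grind
  · by_cases hre : r + 1 = e
    · have h1 := raiseL_interlace hs h hre hp
      have h2 := hs.low
      have h3 := hs.upper r hre
      rw [hL (r + 1) _ (by omega)]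
      rw [hre] at *
      exact ⟨by omega, fun hV => absurd h2.2.1 hV⟩
    · rw [hL r p hre]
      have h1 := h.right r p hr hp
      by_cases hre2 : r + 2 = e
      · have h2 := hs.upper (r + 1) (by omega)
        have h3 := hs.top r hre2
        have h4 := hs.other r (by omega) (by omega)
        simp only [raiseL]
        grind
      · rw [hL (r + 1) _ (by omega)]
        have h2 := hs.other (r + 1)
        have h3 := hs.low
        have h4 := hs.other r
        simp only [raiseB]
        grind

/-- The interlacing of the rows `e - 2` and `e - 1` after lowering. -/
lemma lowerL_interlace (hs : RaiseStep n e V V' k k') (h : AdmissibleValues n V' k' L B) {r p : ℕ}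
    (hr : r + 2 = e) (hp : p ≤ r) :
    lowerL e L B (r + 1) p ≤ L r p ∧ L r p < lowerL e L B (r + 1) (p + 1) := by
  have h1 := h.left r p (by have := hs.lt; omega) hp
  have h2 := h.right r p (by have := hs.lt; omega) hp
  have h3 := hs.upper (r + 1) (by omega)
  have h4 := hs.top r hr
  have h5 := hs.other r (by omega) (by omega)
  simp only [lowerL]
  grind

lemma AdmissibleValues.lower (hs : RaiseStep n e V V' k k') (h : AdmissibleValues n V' k' L B) :
    AdmissibleValues n V k (lowerL e L B) (lowerB e L B) := by
  have hlt := hs.lt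
  have hlow := hs.low
  have hL : ∀ r p, r + 1 ≠ e → lowerL e L B r p = L r p := by
    intro r p hr; simp [lowerL, hr]
  have hrow : ∀ r p, r + 1 = e → p < r → lowerL e L B r p < lowerL e L B r (p + 1) := by
    intro r p hre hp
    obtain ⟨q, rfl⟩ : ∃ q, r = q + 1 := ⟨r - 1, by omega⟩
    have h1 := lowerL_interlace hs h (r := q) (p := p) (by omega) (by omega)
    omega
  refine ⟨fun r p hr hp => ?_, fun r p hr hp => ?_, fun r p hr hp => ?_, fun r p hr hp => ?_,
    fun r p hr hp => ?_⟩
  · rw [hL r p (by omega)]; exact h.bottom r p hr hp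
  · have h1 := h.bounds r p hr hp
    have h2 := hs.other r
    have h4 := hs.upper r
    simp only [lowerL]
    grind
  · by_cases hre : r + 1 = e
    · exact hrow r p hre hp
    · rw [hL _ _ hre, hL _ _ hre]
      exact h.row r p hr hp
  · by_cases hre : r + 1 = e
    · have h1 := h.left r p hr hp
      rw [hL (r + 1) p (by omega)]
      refine ⟨by simp only [lowerL]; grind, fun _ hB => ?_⟩
      by_cases hp0 : 1 ≤ p
      · obtain ⟨q, rfl⟩ : ∃ q, p = q + 1 := ⟨p - 1, by omega⟩
        have h2 := hrow r q hre (by omega)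
        simp only [lowerL, lowerB] at *
        grind
      · simp only [lowerL, lowerB] at *
        grind
    · rw [hL r p hre]
      by_cases hre2 : r + 2 = e
      · have h1 := lowerL_interlace hs h hre2 hp
        exact ⟨h1.1, fun hV => absurd (hs.upper (r + 1) (by omega)).1 hV⟩
      · have h1 := h.left r p hr hp
        rw [hL (r + 1) p (by omega)]
        refine ⟨h1.1, fun hV => ?_⟩
        have h2 := hs.other (r + 1)
        simp only [lowerB]
        grind
  · by_cases hre : r + 1 = e
    · have h1 := h.right r p hr hp
      have h3 := hs.upper r hre
      rw [hL (r + 1) _ (by omega)]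
      refine ⟨by simp only [lowerL]; grind, fun _ hB => ?_⟩
      by_cases hp0 : p < r
      · have h2 := hrow r p hre (by omega)
        simp only [lowerL, lowerB] at *
        grind
      · simp only [lowerL, lowerB] at *
        grind
    · rw [hL r p hre]
      by_cases hre2 : r + 2 = e
      · have h1 := lowerL_interlace hs h hre2 hp
        have h2 := hs.upper (r + 1) (by omega)
        have h3 := hs.top r hre2
        exact ⟨by omega, fun hV => absurd h2.1 hV⟩
      · have h1 := h.right r p hr hp
        rw [hL (r + 1) _ (by omega)]
        have h2 := hs.other (r + 1)
        have h4 := hs.other r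
        simp only [lowerB]
        grind


lemma lowerB_raise (hs : RaiseStep n e V V' k k') (h : AdmissibleValues n V k L B) {r p : ℕ}
    (hp : p ≤ r) :
    lowerB e (raiseL e L B) (raiseB e L B) r p ↔ B r p := by
  have hlt := hs.lt
  have hlow := hs.low
  by_cases hre : r + 1 = e
  · have h1 := h.left r p (by omega) hp
    have h2 := h.right r p (by omega) hp
    have h3 := hs.upper r hre
    simp only [lowerB, raiseL, raiseB, Nat.add_sub_cancel]
    grind
  · by_cases hr : r = e
    · obtain rfl | ⟨q, rfl⟩ : r = 0 ∨ ∃ q, r = q + 1 := by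
        cases r
        · simp
        · simp
      · simp only [lowerB, raiseL, raiseB]
        grind
      · have h1 := h.left q p (by omega)
        have h2 := h.right q p (by omega)
        have h3 := h.left q (p - 1) (by omega) (by omega)
        have h4 := h.right q (p - 1) (by omega) (by omega)
        have h5 := hs.upper q hr
        simp only [lowerB, raiseL, raiseB, Nat.add_sub_cancel]
        grind
    · simp [lowerB, raiseB, hre, hr]

lemma lowerL_raise (r p : ℕ) : lowerL e (raiseL e L B) (raiseB e L B) r p = L r p := by
  simp only [lowerL, raiseL]
  grind

lemma raiseB_lower (hs : RaiseStep n e V V' k k') (h : AdmissibleValues n V' k' L B) {r p : ℕ}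
    (hp : p ≤ r) :
    raiseB e (lowerL e L B) (lowerB e L B) r p ↔ B r p := by
  have hlt := hs.lt
  have hlow := hs.low
  by_cases hre : r + 1 = e
  · have h1 := h.left r p (by omega) hp
    have h2 := h.right r p (by omega) hp
    have h3 := hs.upper r hre
    simp only [lowerB, lowerL, raiseB, Nat.add_sub_cancel]
    grind
  · by_cases hr : r = e
    · obtain rfl | ⟨q, rfl⟩ : r = 0 ∨ ∃ q, r = q + 1 := by
        cases r
        · simp
        · simp
      · simp only [lowerB, lowerL, raiseB]
        grind
      · have h1 := h.left q p (by omega)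
        have h2 := h.right q p (by omega)
        have h3 := h.left q (p - 1) (by omega) (by omega)
        have h4 := h.right q (p - 1) (by omega) (by omega)
        have h5 := hs.upper q hr
        simp only [lowerB, lowerL, raiseB, Nat.add_sub_cancel]
        grind
    · simp [lowerB, raiseB, hre, hr]

lemma raiseL_lower (hs : RaiseStep n e V V' k k') (h : AdmissibleValues n V' k' L B) {r p : ℕ}
    (hp : p ≤ r) :
    raiseL e (lowerL e L B) (lowerB e L B) r p = L r p := by
  have h1 := raiseB_lower hs h hp
  simp only [raiseL, h1, lowerL]
  grind

end Values

section Operators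

variable {n e : ℕ} {V V' : ℕ → Prop} {k k' : ℕ → ℤ} {L L' : ℕ → ℕ → ℤ} {B B' : ℕ → ℕ → Prop}
  {t t' : Tri n}

lemma Encodes.unique {W : Prop} {κ l : ℤ} {b : Prop} {s s' : TSym n} (h : Encodes W κ l b s)
    (h' : Encodes W κ l b s') : s = s' := by
  cases s <;> cases s' <;> simp only [Encodes] at h h' <;> simp [Fin.ext_iff] <;> grind

lemma Represents.unique (h : Represents t V k L B) (h' : Represents t' V k L' B')
    (hL : ∀ r p, p ≤ r → L' r p = L r p) (hB : ∀ r p, p ≤ r → (B' r p ↔ B r p)) :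
    t' = t := by
  funext r p
  by_cases hr : r.val + 1 < n
  · have h1 := h'.entry r p hr
    rw [hL r p (by omega), propext (hB r p (by omega))] at h1
    exact h1.unique (h.entry r p hr)
  · rw [h.bottom r (by omega), h'.bottom r (by omega)]

lemma Represents.isVRow_iff (h : Represents t V k L B) (hk : ∀ r, r + 1 < n → 0 < k r)
    (r : Fin n) : IsVRow t r ↔ r.val + 1 < n ∧ V r := by
  constructor
  · rintro ⟨κ, hκ⟩
    have h1 := hκ ⟨0, by omega⟩
    by_cases hr : r.val + 1 < n
    · have h2 := h.entry r ⟨0, by omega⟩ hr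
      refine ⟨hr, ?_⟩
      revert h1 h2
      cases t r ⟨0, by omega⟩ <;> simp +contextual [TSym.isV, Encodes]
    · rw [h.bottom r (by omega)] at h1
      exact h1.elim
  · rintro ⟨hr, hV⟩
    refine ⟨(k r).toNat, fun p => ?_⟩
    have h1 := hk r hr
    have h2 := h.entry r p hr
    revert h2
    cases t r p <;> simp +contextual only [TSym.isV, Encodes, hV, not_true_eq_false, false_and,
      IsEmpty.forall_iff] <;> omega

lemma Represents.raise (hs : RaiseStep n e V V' k k') (h : AdmissibleValues n V k L B)
    (ht : Represents t V k L B) (hk : (rankOf t e : ℤ) = k e) :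
    Represents (Raise (e + 1) t) V' k' (raiseL e L B) (raiseB e L B) := by
  have hlt := hs.lt
  have hlow := hs.low
  refine ⟨fun r hr p => ?_, fun r p hr => ?_⟩
  · rw [← ht.bottom r hr p]
    simp only [Raise]
    rw [dif_neg (by omega), dif_neg (by omega)]
  · have h0 := ht.entry r p hr
    have hb := h.bounds r p r.isLt (by omega)
    by_cases hre : r.val + 1 = e
    · have h1 := ht.entry ⟨r.val + 1, hr⟩ ⟨p.val, by simp only; omega⟩ (by simp only; omega)
      have h2 := ht.entry ⟨r.val + 1, hr⟩ ⟨p.val + 1, by simp; omega⟩ (by simp only; omega)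
      have h3 := hs.upper r hre
      simp only [Raise]
      rw [dif_pos (by omega)]
      simp only [raiseL, raiseB, hre, if_true, true_and] at *
      generalize t r p = s at *
      generalize t ⟨r.val + 1, hr⟩ ⟨p.val, _⟩ = s1 at *
      generalize t ⟨r.val + 1, hr⟩ ⟨p.val + 1, _⟩ = s2 at *
      cases s <;> simp only [Encodes] at h0 <;> cases s1 <;> simp only [Encodes] at h1 <;>
        cases s2 <;> simp only [Encodes] at h2 <;>
        simp only [TSym.x.injEq, TSym.y.injEq, Fin.ext_iff, reduceCtorEq, if_false] <;>
        try split_ifs <;> simp only [Encodes] <;> grind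
    · simp only [Raise]
      rw [dif_neg (by omega)]
      by_cases hr' : r.val = e
      · subst hr'
        rw [dif_pos (by omega)]
        have h3 := hs.upper (r.val - 1)
        simp only [raiseL, raiseB, if_true, if_false, Nat.add_eq_left, one_ne_zero,
          false_and]
        generalize t r p = s at *
        cases s <;> simp only [Encodes] at h0
        · by_cases hi : p.val < r.val
          · have h1 := ht.entry ⟨r.val - 1, by omega⟩ ⟨p.val, by simp only; omega⟩
              (by simp only; omega)
            simp only [hi, dite_true]
            generalize t ⟨r.val - 1, _⟩ ⟨p.val, _⟩ = s1 at *
            cases s1 <;> simp only [Encodes] at h1 <;> split_ifs <;> simp only [Encodes] <;> grind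
          · simp only [hi, dite_false]
            split_ifs <;> simp only [Encodes] <;> grind
        · by_cases hi : 1 ≤ p.val
          · have h1 := ht.entry ⟨r.val - 1, by omega⟩ ⟨p.val - 1, by simp only; omega⟩
              (by simp only; omega)
            simp only [hi, dite_true]
            generalize t ⟨r.val - 1, _⟩ ⟨p.val - 1, _⟩ = s1 at *
            cases s1 <;> simp only [Encodes] at h1 <;> split_ifs <;> simp only [Encodes] <;> grind
          · simp only [hi, dite_false]
            split_ifs <;> simp only [Encodes] <;> grind
        · grind
        · grind
      · rw [dif_neg (by omega)]
        simpa [raiseL, raiseB, hre, hr', hs.other r hr' hre] using h0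

lemma Represents.lower (hs : RaiseStep n e V V' k k') (h : AdmissibleValues n V' k' L B)
    (ht : Represents t V' k' L B) (hk : (rankOf t e : ℤ) = k e) :
    Represents (Lower (e + 1) t) V k (lowerL e L B) (lowerB e L B) := by
  have hlt := hs.lt
  have hlow := hs.low
  refine ⟨fun r hr p => ?_, fun r p hr => ?_⟩
  · rw [← ht.bottom r hr p]
    simp only [Lower]
    rw [dif_neg (by omega), dif_neg (by omega)]
  · have h0 := ht.entry r p hr
    have hb := h.bounds r p r.isLt (by omega)
    by_cases hre : r.val + 1 = e
    · have h3 := hs.upper r hre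
      simp only [Lower]
      rw [dif_pos (by omega)]
      subst hre
      simp only [lowerL, lowerB, if_true, true_and]
      generalize t r p = s at *
      cases s <;> simp only [Encodes] at h0
      · have h1 := ht.entry ⟨r.val + 1, hr⟩ ⟨p.val, by simp only; omega⟩ (by simp only; omega)
        generalize t ⟨r.val + 1, hr⟩ ⟨p.val, _⟩ = s1 at *
        cases s1 <;> simp only [Encodes] at h1 <;> split_ifs <;> simp only [Encodes] <;> grind
      · have h1 := ht.entry ⟨r.val + 1, hr⟩ ⟨p.val + 1, by simp; omega⟩ (by simp only; omega)
        generalize t ⟨r.val + 1, hr⟩ ⟨p.val + 1, _⟩ = s1 at *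
        cases s1 <;> simp only [Encodes] at h1 <;> split_ifs <;> simp only [Encodes] <;> grind
      · grind
      · grind
    · simp only [Lower]
      rw [dif_neg (by omega)]
      by_cases hr' : r.val = e
      · subst hr'
        rw [dif_pos (by omega)]
        have h3 := hs.upper (r.val - 1)
        simp only [lowerL, lowerB, if_true, if_false, Nat.add_eq_left, one_ne_zero,
          false_and]
        generalize t r p = s at *
        cases s <;> simp only [Encodes] at h0
        · grind
        · grind
        · by_cases hi : 1 ≤ p.val
          · have h1 := ht.entry ⟨r.val - 1, by omega⟩ ⟨p.val - 1, by simp only; omega⟩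
              (by simp only; omega)
            simp only [hi, dite_true]
            generalize t ⟨r.val - 1, _⟩ ⟨p.val - 1, _⟩ = s1 at *
            cases s1 <;> simp only [Encodes] at h1 <;> split_ifs <;> simp only [Encodes] <;> grind
          · simp only [hi, dite_false, Encodes]
            grind
        · by_cases hi : p.val < r.val
          · have h1 := ht.entry ⟨r.val - 1, by omega⟩ ⟨p.val, by simp only; omega⟩
              (by simp only; omega)
            simp only [hi, dite_true]
            generalize t ⟨r.val - 1, _⟩ ⟨p.val, _⟩ = s1 at *
            cases s1 <;> simp only [Encodes] at h1 <;> split_ifs <;> simp only [Encodes] <;> grind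
          · simp only [hi, dite_false, Encodes]
            grind
      · rw [dif_neg (by omega)]
        simpa [lowerL, lowerB, hre, hr', hs.other r hr' hre] using h0

end Operators

section Weights

/-- The weight of the entry with left value `l` and left-orientation `b` in a row of rank `κ`. -/
noncomputable def valueWeight (n : ℕ) (κ l : ℤ) (b : Prop) : MvPolynomial (Fin n ⊕ Fin n) ℤ :=
  if b then (if h : (l + κ).toNat < n then MvPolynomial.X (Sum.inr ⟨(l + κ).toNat, h⟩) else 1)
  else (if h : l.toNat < n then MvPolynomial.X (Sum.inl ⟨l.toNat, h⟩) else 1)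

variable {n e : ℕ} {V V' : ℕ → Prop} {k k' : ℕ → ℤ} {L : ℕ → ℕ → ℤ} {B : ℕ → ℕ → Prop}
  {t : Tri n}

lemma valueWeight_true_shift (n : ℕ) (κ l : ℤ) :
    valueWeight n (κ + 1) (l - 1) True = valueWeight n κ l True := by
  simp only [valueWeight, if_true, show l - 1 + (κ + 1) = l + κ by ring]

lemma valueWeight_false_congr (n : ℕ) (κ κ' l : ℤ) :
    valueWeight n κ l False = valueWeight n κ' l False := by
  simp [valueWeight]

lemma Encodes.weight_eq {W : Prop} {κ l : ℤ} {b : Prop} {s : TSym n} (h : Encodes W κ l b s) :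
    s.weight = valueWeight n κ l b := by
  cases s with
  | x i => obtain ⟨_, hb, rfl⟩ := h; simp [TSym.weight, valueWeight, hb]
  | y j => obtain ⟨_, hb, hj⟩ := h; simp [TSym.weight, valueWeight, hb, ← hj]
  | a i j => obtain ⟨_, hb, rfl, _⟩ := h; simp [TSym.weight, valueWeight, hb]
  | b i j => obtain ⟨_, hb, _, hj⟩ := h; simp [TSym.weight, valueWeight, hb, ← hj]
  | num i => exact h.elim

lemma Represents.weight_eq (h : Represents t V k L B) :
    weight t = ∏ r ∈ range (n - 1), ∏ p ∈ range (r + 1), valueWeight n (k r) (L r p) (B r p) := by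
  let F : ℕ → MvPolynomial (Fin n ⊕ Fin n) ℤ := fun r => if r < n - 1 then
    ∏ p ∈ range (r + 1), valueWeight n (k r) (L r p) (B r p) else 1
  have h1 : ∀ r : Fin n, (if r.val < n - 1 then ∏ i, (t r i).weight else 1) = F r := by
    intro r
    dsimp only [F]
    split_ifs with hr
    · rw [Finset.prod_range]
      exact Finset.prod_congr rfl fun p _ => (h.entry r p (by omega)).weight_eq
    · rfl
  rw [weight, Finset.prod_congr rfl fun r _ => h1 r, ← Finset.prod_range F, ← Finset.prod_filter]
  refine Finset.prod_congr ?_ fun _ _ => rfl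
  ext r
  simp only [Finset.mem_filter, Finset.mem_range]
  omega

/-- The factors of two adjacent rows `a`, `c` can be regrouped along diagonals, where the
entries of `c` satisfying `y` are matched with their upper left neighbour and the others with
their upper right neighbour. -/
lemma prod_adjacent_rows {M : Type*} [CommMonoid M] (N : ℕ) (y : ℕ → Prop) (a a' c c' : ℕ → M)
    (hmid : ∀ p < N, a p * (if y p then 1 else c p) * (if y (p + 1) then c (p + 1) else 1) =
      a' p * (if y p then 1 else c' p) * (if y (p + 1) then c' (p + 1) else 1))
    (hlast : ¬y N → c N = c' N) (hfirst : y 0 → c 0 = c' 0) :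
    (∏ p ∈ range N, a p) * ∏ p ∈ range (N + 1), c p =
      (∏ p ∈ range N, a' p) * ∏ p ∈ range (N + 1), c' p := by
  have key : ∀ a c : ℕ → M, (∏ p ∈ range N, a p) * ∏ p ∈ range (N + 1), c p =
      (∏ p ∈ range N,
        a p * (if y p then 1 else c p) * (if y (p + 1) then c (p + 1) else 1)) *
      ((if y N then 1 else c N) * (if y 0 then c 0 else 1)) := by
    intro a c
    have h1 : ∏ p ∈ range (N + 1), c p =
        ∏ p ∈ range (N + 1), (if y p then 1 else c p) * (if y p then c p else 1) :=
      Finset.prod_congr rfl fun p _ => by split_ifs <;> simp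
    rw [h1, Finset.prod_mul_distrib, Finset.prod_range_succ, Finset.prod_range_succ' _ N,
      Finset.prod_mul_distrib, Finset.prod_mul_distrib]
    simp only [mul_assoc, mul_left_comm, mul_comm]
  rw [key a c, key a' c', Finset.prod_congr rfl fun p hp => hmid p (Finset.mem_range.mp hp)]
  congr 2
  · split_ifs with h
    · rfl
    · exact hlast h
  · split_ifs with h
    · exact hfirst h
    · rfl

lemma prod_valueWeight_raise (hs : RaiseStep n e V V' k k') (h : AdmissibleValues n V k L B) :
    ∏ r ∈ range (n - 1), ∏ p ∈ range (r + 1),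
      valueWeight n (k' r) (raiseL e L B r p) (raiseB e L B r p) =
    ∏ r ∈ range (n - 1), ∏ p ∈ range (r + 1), valueWeight n (k r) (L r p) (B r p) := by
  have hlt := hs.lt
  have hlow := hs.low
  have hother : ∀ r p, r ≠ e → r + 1 ≠ e →
      valueWeight n (k' r) (raiseL e L B r p) (raiseB e L B r p) =
        valueWeight n (k r) (L r p) (B r p) := by
    intro r p h1 h2
    simp [raiseL, raiseB, h1, h2, hs.other]
  obtain rfl | ⟨f, rfl⟩ : e = 0 ∨ ∃ f, e = f + 1 := by cases e <;> simp
  · refine Finset.prod_congr rfl fun r _ => Finset.prod_congr rfl fun p hp => ?_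
    by_cases hr : r = 0
    · subst hr
      simp at hp
      subst hp
      simp [raiseL, raiseB, hlow]
    · exact hother r p hr (by omega)
  · have hmem : f + 1 ∈ range (n - 1) := by simp; omega
    have hmem' : f ∈ (range (n - 1)).erase (f + 1) := by simp; omega
    rw [← Finset.mul_prod_erase _ _ hmem, ← Finset.mul_prod_erase _ _ hmem,
      ← Finset.mul_prod_erase _ _ hmem', ← Finset.mul_prod_erase _ _ hmem', ← mul_assoc,
      ← mul_assoc]
    congr 1
    · rw [mul_comm, mul_comm (∏ p ∈ range (f + 1 + 1), _)]
      have hup := hs.upper f rfl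
      refine prod_adjacent_rows (f + 1) (B (f + 1)) _ _ _ _ (fun p hp => ?_) (fun hy => ?_)
        fun hy => ?_
      · have h1 := h.left f p (by omega) (by omega)
        have h2 := h.right f p (by omega) (by omega)
        have h3 := h.row (f + 1) p (by omega) (by omega)
        have hk : ∀ l, valueWeight n (k (f + 1) + 1) l False = valueWeight n (k (f + 1)) l False :=
          fun l => valueWeight_false_congr n _ _ l
        have hp' : p ≤ f := by omega
        by_cases hb : B f p <;> by_cases hu : B (f + 1) p <;> by_cases hw : B (f + 1) (p + 1) <;>
          by_cases e1 : L (f + 1) p = L f p <;> by_cases e2 : L (f + 1) (p + 1) = L f p <;>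
          first
          | omega
          | simp [raiseB, raiseL, hb, hu, hw, e1, e2, hp', hup, hlow, hk, valueWeight_true_shift,
              mul_comm, mul_left_comm, eq_comm (a := L f p) (b := L (f + 1) p),
              eq_comm (a := L f p) (b := L (f + 1) (p + 1))]
      · simp [raiseB, raiseL, hy, hlow]
      · simp [raiseB, raiseL, hy, hlow]
    · refine Finset.prod_congr rfl fun r hr => Finset.prod_congr rfl fun p hp => ?_
      simp at hr
      exact hother r p (by omega) (by omega)

end Weights

section Stages

variable {n : ℕ} {t : Tri n}

/-- The `𝒱`-rows after applying `R_{d+1} ∘ ⋯ ∘ R_m` to a triangle whose first `m - 1` rows are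
`𝒱`-rows. -/
def stageV (m d r : ℕ) : Prop := r < m ∧ r + 1 ≠ d

/-- The ranks corresponding to `stageV`. -/
noncomputable def stageRank (n m d r : ℕ) : ℤ :=
  if r + 1 = n then 0 else 1 + (m - (r + 1) : ℕ) - if r + 1 < d then 1 else 0

/-- The `𝒱`-rows as in `stageV`, together with the bottom row. -/
def stageRows (n m d r : ℕ) : Prop := stageV m d r ∨ r + 1 = n

lemma raiseStep_stage {m e : ℕ} (he : e + 1 ≤ m) (hm : m + 1 ≤ n) :
    RaiseStep n e (stageRows n m (e + 1)) (stageRows n m e) (stageRank n m (e + 1))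
      (stageRank n m e) := by
  constructor
  · omega
  · simp only [stageRows, stageV, stageRank]
    grind
  · intro r hr
    simp only [stageRows, stageV, stageRank]
    grind
  · intro r hr
    simp only [stageRank]
    grind
  · intro r h1 h2
    simp only [stageRows, stageV, stageRank]
    grind

lemma stageRank_pos {m d r : ℕ} (hd : d ≤ m) (hr : r + 1 < n) : 0 < stageRank n m d r := by
  simp only [stageRank]
  grind

lemma rankOf_stage {m d e : ℕ} {L : ℕ → ℕ → ℤ} {B : ℕ → ℕ → Prop} (hd : d ≤ m)
    (hde : d = e ∨ d = e + 1) (he : e + 1 ≤ m) (hm : m + 1 ≤ n)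
    (h : Represents t (stageRows n m d) (stageRank n m d) L B) :
    (rankOf t e : ℤ) = stageRank n m (e + 1) e := by
  have h1 : (univ.filter fun s : Fin n => e < s.val ∧ IsVRow t s) =
      Finset.Ioo ⟨e, by omega⟩ ⟨m, by omega⟩ := by
    ext s
    rw [Finset.mem_filter, h.isVRow_iff fun r hr => stageRank_pos hd hr]
    simp only [Finset.mem_univ, true_and, Finset.mem_Ioo, Fin.lt_def, stageRows, stageV]
    omega
  rw [rankOf, h1, Fin.card_Ioo]
  simp only [stageRank]
  grind

/-- Admissible triangles with the `𝒱`-rows prescribed by `stageV m d`. -/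
def InStage (m d : ℕ) (t : Tri n) : Prop :=
  ∃ L B, Represents t (stageRows n m d) (stageRank n m d) L B ∧
    AdmissibleValues n (stageRows n m d) (stageRank n m d) L B

lemma InStage.next {m : ℕ} (h : InStage m 0 t) : InStage (m + 1) (m + 1) t := by
  have h1 : stageRows n (m + 1) (m + 1) = stageRows n m 0 := by
    funext r; simp only [stageRows, stageV]; grind
  have h2 : stageRank n (m + 1) (m + 1) = stageRank n m 0 := by
    funext r; simp only [stageRank]; grind
  rwa [InStage, h1, h2]

lemma InStage.prev {m : ℕ} (h : InStage (m + 1) (m + 1) t) : InStage m 0 t := by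
  have h1 : stageRows n (m + 1) (m + 1) = stageRows n m 0 := by
    funext r; simp only [stageRows, stageV]; grind
  have h2 : stageRank n (m + 1) (m + 1) = stageRank n m 0 := by
    funext r; simp only [stageRank]; grind
  rwa [InStage, h1, h2] at h

lemma InStage.raise {m e : ℕ} (he : e + 1 ≤ m) (hm : m + 1 ≤ n) (h : InStage m (e + 1) t) :
    InStage m e (Raise (e + 1) t) ∧ Lower (e + 1) (Raise (e + 1) t) = t ∧
      weight (Raise (e + 1) t) = weight t := by
  obtain ⟨L, B, ht, ha⟩ := h
  have hs := raiseStep_stage he hm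
  have ht' := ht.raise hs ha (rankOf_stage he (Or.inr rfl) he hm ht)
  have ha' := ha.raise hs
  refine ⟨⟨_, _, ht', ha'⟩, ?_, ?_⟩
  · exact ht.unique (ht'.lower hs ha' (rankOf_stage (by omega) (Or.inl rfl) he hm ht'))
      (fun r p _ => lowerL_raise r p) fun r p hp => lowerB_raise hs ha hp
  · rw [ht.weight_eq, ht'.weight_eq, prod_valueWeight_raise hs ha]

lemma InStage.lower {m e : ℕ} (he : e + 1 ≤ m) (hm : m + 1 ≤ n) (h : InStage m e t) :
    InStage m (e + 1) (Lower (e + 1) t) ∧ Raise (e + 1) (Lower (e + 1) t) = t ∧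
      weight (Lower (e + 1) t) = weight t := by
  obtain ⟨L, B, ht, ha⟩ := h
  have hs := raiseStep_stage he hm
  have ht' := ht.lower hs ha (rankOf_stage (by omega) (Or.inl rfl) he hm ht)
  have ha' := ha.lower hs
  have hr : Raise (e + 1) (Lower (e + 1) t) = t :=
    ht.unique (ht'.raise hs ha' (rankOf_stage he (Or.inr rfl) he hm ht'))
      (fun r p hp => raiseL_lower hs ha hp) fun r p hp => raiseB_lower hs ha hp
  have hst : InStage m (e + 1) (Lower (e + 1) t) := ⟨_, _, ht', ha'⟩
  refine ⟨hst, hr, ?_⟩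
  rw [← (hst.raise he hm).2.2, hr]

lemma inStage_raiseBlock {m : ℕ} (hm : m + 1 ≤ n) {d : ℕ} (hd : d ≤ m) (h : InStage m d t) :
    InStage m 0 (raiseBlock d t) ∧ lowerBlock d (raiseBlock d t) = t ∧
      weight (raiseBlock d t) = weight t := by
  induction d generalizing t with
  | zero => exact ⟨h, rfl, rfl⟩
  | succ d ih =>
    obtain ⟨h1, h2, h3⟩ := h.raise hd hm
    obtain ⟨h4, h5, h6⟩ := ih (by omega) h1
    exact ⟨h4, by simp only [lowerBlock, raiseBlock, h5, h2], h6.trans h3⟩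

lemma inStage_lowerBlock {m : ℕ} (hm : m + 1 ≤ n) {d : ℕ} (hd : d ≤ m) (h : InStage m 0 t) :
    InStage m d (lowerBlock d t) ∧ raiseBlock d (lowerBlock d t) = t ∧
      weight (lowerBlock d t) = weight t := by
  induction d with
  | zero => exact ⟨h, rfl, rfl⟩
  | succ d ih =>
    obtain ⟨h1, h2, h3⟩ := ih (by omega)
    obtain ⟨h4, h5, h6⟩ := h1.lower hd hm
    exact ⟨h4, by simp only [lowerBlock, raiseBlock, h5, h2], h6.trans h3⟩

lemma InStage.phiFun {m : ℕ} (hm : m ≤ n - 1) (h : InStage 0 0 t) :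
    InStage m 0 (PhiFun m t) ∧ PsiFun m (PhiFun m t) = t ∧ weight (PhiFun m t) = weight t := by
  induction m with
  | zero => exact ⟨h, rfl, rfl⟩
  | succ m ih =>
    obtain ⟨h1, h2, h3⟩ := ih (by omega)
    obtain ⟨h4, h5, h6⟩ := inStage_raiseBlock (by omega) le_rfl h1.next
    exact ⟨h4, by simp only [PsiFun, PhiFun, h5, h2], h6.trans h3⟩

lemma InStage.psiFun {m : ℕ} (hm : m ≤ n - 1) (h : InStage m 0 t) :
    InStage 0 0 (PsiFun m t) ∧ PhiFun m (PsiFun m t) = t ∧ weight (PsiFun m t) = weight t := by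
  induction m generalizing t with
  | zero => exact ⟨h, rfl, rfl⟩
  | succ m ih =>
    obtain ⟨h1, h2, h3⟩ := inStage_lowerBlock (by omega) le_rfl h
    obtain ⟨h4, h5, h6⟩ := ih (by omega) h1.prev
    exact ⟨h4, by simp only [PsiFun, PhiFun, h5, h2], h6.trans h3⟩

end Stages

section Endpoints

variable {n : ℕ} {t : Tri n} {L : ℕ → ℕ → ℤ} {B : ℕ → ℕ → Prop}

lemma stageRows_initial (r : ℕ) : stageRows n 0 0 r ↔ r + 1 = n := by
  simp [stageRows, stageV]

lemma stageRank_initial (r : ℕ) : stageRank n 0 0 r = if r + 1 = n then 0 else 1 := by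
  simp [stageRank]

lemma stageRows_final {r : ℕ} (hr : r < n) : stageRows n (n - 1) 0 r := by
  simp only [stageRows, stageV]
  omega

lemma stageRank_final {r : ℕ} (hr : r < n) : stageRank n (n - 1) 0 r = n - 1 - r := by
  simp only [stageRank]
  grind

lemma Represents.xyval_eq
    (h : Represents t (stageRows n 0 0) (stageRank n 0 0) L B)
    (hL : ∀ r p, r + 1 = n → p ≤ r → L r p = p) (r : Fin n) (p : Fin (r.val + 1)) :
    xyval (t r p) = L r p + 1 + if B r p ∧ r.val + 1 < n then 1 else 0 := by
  by_cases hr : r.val + 1 < n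
  · have h1 := h.entry r p hr
    have h2 := stageRows_initial (n := n) r.val
    have h3 := stageRank_initial (n := n) r.val
    cases hs : t r p <;> simp only [hs, Encodes] at h1 <;> simp only [xyval] <;> grind
  · rw [h.bottom r (by omega), hL r p (by omega) (by omega)]
    simp [xyval, hr]

lemma Represents.eq_x_iff (h : Represents t (stageRows n 0 0) (stageRank n 0 0) L B)
    (r : Fin n) (p : Fin (r.val + 1)) (hr : r.val + 1 < n) :
    (∃ j, t r p = .x j) ↔ ¬B r p := by
  have h1 := h.entry r p hr
  have h2 := stageRows_initial (n := n) r.val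
  cases hs : t r p <;> simp only [hs, Encodes] at h1 <;> grind

lemma Represents.eq_y_iff (h : Represents t (stageRows n 0 0) (stageRank n 0 0) L B)
    (r : Fin n) (p : Fin (r.val + 1)) (hr : r.val + 1 < n) :
    (∃ j, t r p = .y j) ↔ B r p := by
  have h1 := h.entry r p hr
  have h2 := stageRows_initial (n := n) r.val
  cases hs : t r p <;> simp only [hs, Encodes] at h1 <;> grind

lemma xyval_bounds {r : Fin n} {p : Fin (r.val + 1)}
    (h : Represents t (stageRows n 0 0) (stageRank n 0 0) L B) :
    1 ≤ xyval (t r p) ∧ xyval (t r p) ≤ n := by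
  by_cases hr : r.val + 1 < n
  · have h1 := h.entry r p hr
    have h2 := stageRows_initial (n := n) r.val
    cases hs : t r p <;> simp only [hs, Encodes] at h1 <;> simp only [xyval] <;> grind
  · rw [h.bottom r (by omega)]
    simp only [xyval]
    omega

lemma IsOCMTTri.exists_represents (h : IsOCMTTri t) :
    ∃ L B, Represents t (stageRows n 0 0) (stageRank n 0 0) L B ∧
      ∀ r p, r + 1 = n → p ≤ r → L r p = p := by
  refine ⟨fun r p => if h : r < n ∧ p < r + 1 then (t ⟨r, h.1⟩ ⟨p, h.2⟩).lval 1 - 1 else 0,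
    fun r p => ∃ hr hp j, t ⟨r, hr⟩ ⟨p, hp⟩ = .y j, ⟨h.1, fun r p hr => ?_⟩, fun r p hr hp => ?_⟩
  · have h1 := h.2.1 r (by omega) p
    have h2 : ¬stageRows n 0 0 r := by rw [stageRows_initial]; omega
    have h3 : stageRank n 0 0 r = 1 := by rw [stageRank_initial, if_neg (by omega)]
    have hp : p.val ≤ r.val := by omega
    cases hs : t r p <;> simp [hs, TSym.isX] at h1 <;>
      simp [Encodes, hs, h2, h3, TSym.lval, hp]
  · dsimp only
    rw [dif_pos ⟨by omega, by omega⟩, h.1 ⟨r, by omega⟩ (by simp only; omega)]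
    simp [TSym.lval]

lemma IsOCMTTri.inStage (h : IsOCMTTri t) : InStage 0 0 t := by
  obtain ⟨L, B, ht, hL⟩ := h.exists_represents
  have hb : ∀ r p, r < n → p ≤ r →
      1 ≤ L r p + 1 + (if B r p ∧ r + 1 < n then 1 else 0) ∧
      L r p + 1 + (if B r p ∧ r + 1 < n then 1 else 0) ≤ n := by
    intro r p hr hp
    have h1 := xyval_bounds (r := ⟨r, hr⟩) (p := ⟨p, by simp only; omega⟩) ht
    rwa [ht.xyval_eq hL] at h1
  have hi : ∀ r p, r + 1 < n → p ≤ r →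
      L (r + 1) p + (if B (r + 1) p ∧ r + 2 < n then 1 else 0) ≤ L r p ∧
      L r p + 1 ≤ L (r + 1) (p + 1) + (if B (r + 1) (p + 1) ∧ r + 2 < n then 1 else 0) := by
    intro r p hr hp
    have h1 := h.2.2.2.1 ⟨r, by omega⟩ hr ⟨p, by simp only; omega⟩
    have h2 := h.2.2.2.2 ⟨r, by omega⟩ hr ⟨p, by simp only; omega⟩
    rw [ht.eq_x_iff _ _ hr, ht.eq_y_iff _ _ hr] at h2
    simp only [ht.xyval_eq hL] at h1 h2
    grind
  have hleft : ∀ r p, r + 1 < n → p ≤ r → L (r + 1) p ≤ L r p ∧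
      (r + 2 < n → B (r + 1) p → L (r + 1) p < L r p) := by
    intro r p hr hp
    have h1 := hi r p hr hp
    clear hi hb
    grind
  have hright : ∀ r p, r + 1 < n → p ≤ r →
      (r + 2 < n → L r p ≤ L (r + 1) (p + 1)) ∧
      (r + 2 = n → L r p + 1 ≤ L (r + 1) (p + 1)) ∧
      (r + 2 < n → ¬B (r + 1) (p + 1) → L r p < L (r + 1) (p + 1)) := by
    intro r p hr hp
    have h1 := hi r p hr hp
    clear hi hb
    grind
  have hforced : ∀ r p, r + 1 < n → p ≤ r → 0 ≤ L r p ∧ L r p + 1 < n := by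
    intro r p hr hp
    have h1 := hi r p hr hp
    have h2 := hb (r + 1) p (by omega) (by omega)
    have h3 := hb (r + 1) (p + 1) (by omega) (by omega)
    have h4 := hb r p (by omega) (by omega)
    grind
  refine ⟨L, B, ht, ⟨hL, fun r p hr hp => ?_, fun r p hr hp => ?_, fun r p hr hp => ?_,
    fun r p hr hp => ?_⟩⟩
  · rw [stageRank_initial]
    by_cases hr' : r + 1 = n
    · rw [hL r p hr' hp, if_pos hr']
      omega
    · rw [if_neg hr']
      exact hforced r p (by omega) hp
  · by_cases hr' : r + 1 = n
    · rw [hL r p hr' (by omega), hL r (p + 1) hr' (by omega)]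
      push_cast
      omega
    · have h1 := hright r p (by omega) (by omega)
      have h2 := hleft r (p + 1) (by omega) (by omega)
      grind
  · have h1 := hleft r p hr hp
    rw [stageRows_initial]
    exact ⟨h1.1, fun hr' => h1.2 (by omega)⟩
  · have h1 := hright r p hr hp
    rw [stageRows_initial, stageRank_initial, stageRank_initial]
    grind

lemma InStage.isOCMTTri (h : InStage 0 0 t) : IsOCMTTri t := by
  obtain ⟨L, B, ht, ha⟩ := h
  have hL := ha.bottom
  have hleft : ∀ r p, r + 1 < n → p ≤ r → L (r + 1) p ≤ L r p ∧
      (r + 2 < n → B (r + 1) p → L (r + 1) p < L r p) := by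
    intro r p hr hp
    have h1 := ha.left r p hr hp
    rw [stageRows_initial] at h1
    exact ⟨h1.1, fun h => h1.2 (by omega)⟩
  have hright : ∀ r p, r + 1 < n → p ≤ r →
      (r + 2 < n → L r p ≤ L (r + 1) (p + 1)) ∧
      (r + 2 = n → L r p + 1 ≤ L (r + 1) (p + 1)) ∧
      (r + 2 < n → ¬B (r + 1) (p + 1) → L r p < L (r + 1) (p + 1)) := by
    intro r p hr hp
    have h1 := ha.right r p hr hp
    rw [stageRows_initial, stageRank_initial, stageRank_initial] at h1
    grind
  refine ⟨ht.bottom, fun r hr p => ?_, fun r p q hpq => ?_, fun r hr p => ?_, fun r hr p => ?_⟩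
  · have h1 := ht.eq_x_iff r p (by omega)
    have h2 := ht.eq_y_iff r p (by omega)
    by_cases hB : B r p
    · obtain ⟨j, hj⟩ := h2.2 hB
      simp [hj, TSym.isX]
    · obtain ⟨j, hj⟩ := h1.2 hB
      simp [hj, TSym.isX]
  · rw [ht.xyval_eq hL, ht.xyval_eq hL]
    have hstep : ∀ r p : ℕ, r < n → p < r →
        L r p + 1 + (if B r p ∧ r + 1 < n then 1 else 0) <
          L r (p + 1) + 1 + (if B r (p + 1) ∧ r + 1 < n then 1 else 0) := by
      intro r p hr hp
      obtain ⟨s, rfl⟩ : ∃ s, r = s + 1 := ⟨r - 1, by omega⟩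
      have h1 := ha.row (s + 1) p hr hp
      have h2 := hleft s p (by omega) (by omega)
      have h3 := hright s p (by omega) (by omega)
      grind
    have key : ∀ p q : ℕ, p < q → q ≤ r →
        L r p + 1 + (if B r p ∧ r.val + 1 < n then 1 else 0) <
          L r q + 1 + (if B r q ∧ r.val + 1 < n then 1 else 0) := by
      intro p q hpq
      induction q, hpq using Nat.le_induction with
      | base => exact fun hp => hstep r p r.isLt (by omega)
      | succ q hpq ih => exact fun hq => (ih (by omega)).trans (hstep r q r.isLt (by omega))
    exact key p q hpq (by omega)
  · have h1 := hleft r p hr (by omega)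
    have h2 := hright r p hr (by omega)
    simp only [ht.xyval_eq hL]
    grind
  · have h1 := hleft r p hr (by omega)
    have h2 := hright r p hr (by omega)
    rw [ht.eq_x_iff _ _ hr, ht.eq_y_iff _ _ hr]
    simp only [ht.xyval_eq hL]
    grind

lemma IsTournTri.inStage (h : IsTournTri t) : InStage (n - 1) 0 t := by
  refine ⟨fun r p => p, fun r p => ∃ hr hp i j, t ⟨r, hr⟩ ⟨p, hp⟩ = .b i j,
    ⟨h.1, fun r p hr => ?_⟩, ⟨fun r p hr hp => rfl, fun r p hr hp => ?_, fun r p hr hp => ?_,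
      fun r p hr hp => ?_, fun r p hr hp => ?_⟩⟩
  · have h1 := stageRows_final r.isLt
    rw [stageRank_final r.isLt]
    obtain h2 | h2 := h.2 r (by omega) p <;> simp [Encodes, h1, h2] <;> omega
  · rw [stageRank_final hr]
    omega
  · push_cast
    omega
  · exact ⟨le_rfl, fun hV => absurd (stageRows_final hr) hV⟩
  · rw [stageRank_final hr, stageRank_final (by omega)]
    exact ⟨by push_cast; omega, fun hV => absurd (stageRows_final hr) hV⟩

lemma InStage.isTournTri (h : InStage (n - 1) 0 t) : IsTournTri t := by
  obtain ⟨L, B, ht, ha⟩ := h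
  have hL : ∀ s r p, r + s + 1 = n → p ≤ r → L r p = p := by
    intro s
    induction s with
    | zero => exact fun r p hr hp => ha.bottom r p hr hp
    | succ s ih =>
      intro r p hr hp
      have h1 := (ha.left r p (by omega) hp).1
      have h2 := (ha.right r p (by omega) hp).1
      rw [stageRank_final (by omega), stageRank_final (by omega),
        ih (r + 1) (p + 1) (by omega) (by omega)] at h2
      rw [ih (r + 1) p (by omega) (by omega)] at h1
      push_cast at h2
      omega
  refine ⟨ht.bottom, fun r hr p => ?_⟩
  have h1 := ht.entry r p (by omega)
  have h2 := stageRows_final r.isLt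
  rw [stageRank_final r.isLt, hL (n - 1 - r) r p (by omega) (by omega)] at h1
  cases hs : t r p <;> simp only [hs, Encodes] at h1 <;> simp [Fin.ext_iff] <;> grind

end Endpoints

/-- `Φ` is a well-defined weight-preserving bijection from oriented complete monotone
triangles of order `n` to tournaments on `{1,...,n}`, with inverse `Ψ`. -/
theorem stmt17 (n : ℕ) :
    (∀ t : Tri n, IsOCMTTri t →
        IsTournTri (PhiFun (n - 1) t) ∧ weight (PhiFun (n - 1) t) = weight t ∧
        PsiFun (n - 1) (PhiFun (n - 1) t) = t) ∧
    (∀ t : Tri n, IsTournTri t →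
        IsOCMTTri (PsiFun (n - 1) t) ∧ weight (PsiFun (n - 1) t) = weight t ∧
        PhiFun (n - 1) (PsiFun (n - 1) t) = t) := by
  refine ⟨fun t ht => ?_, fun t ht => ?_⟩
  · obtain ⟨h1, h2, h3⟩ := ht.inStage.phiFun le_rfl
    exact ⟨h1.isTournTri, h3, h2⟩
  · obtain ⟨h1, h2, h3⟩ := ht.inStage.psiFun le_rfl
    exact ⟨h1.isOCMTTri, h3, h2⟩
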